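/- Let {ν_{nk}} be an infinitesimal array of probability measures on ℝ, let {c_n}_{n≥1} ⊂ ℝ, and fix y ≥ 1. Then the sequence c_n + Σ_{k=1}^{k_n} E_{ν_{nk}}(iy) converges in ℂ as n → ∞ if and only if the sequence c_n + Σ_{k=1}^{k_n} [a_{nk} + f_{nk}(iy)] converges in ℂ as n → ∞, and when they converge the two sequences have the same limit. -/

import Mathlib

open MeasureTheory Complex Filter Topology

noncomputable section

/-- Cauchy transform G_μ(z) = ∫ (z−t)⁻¹ dμ(t), z ∈ ℂ⁺. -/
def cauchyT (μ : Measure ℝ) (z : ℂ) : ℂ := ∫ t : ℝ, (z - (t : ℂ))⁻¹ ∂μ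

/-- E_μ(z) = z − F_μ(z), where F_μ = 1/G_μ. -/
def ET (μ : Measure ℝ) (z : ℂ) : ℂ := z - (cauchyT μ z)⁻¹

/-- Infinitesimal triangular array on ℝ: max_{1≤k≤k_n} ν_{nk}{|t| ≥ ε} → 0 as n → ∞. -/
def IsInfinitesimalArrayR (kn : ℕ → ℕ) (ν : ℕ → ℕ → Measure ℝ) : Prop :=
  ∀ ε : ℝ, 0 < ε → ∀ δ : ENNReal, 0 < δ → ∃ N : ℕ, ∀ n ≥ N, ∀ i < kn n,
    ν n i {t : ℝ | ε ≤ |t|} < δ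

/-- a = ∫_{|t|<1} t dν(t). -/
def aR (ν : Measure ℝ) : ℝ := ∫ t in {t : ℝ | |t| < 1}, t ∂ν

/-- ν° : the centering of ν, pushforward under t ↦ t − a. -/
def centerR (ν : Measure ℝ) : Measure ℝ := Measure.map (fun t => t - aR ν) ν

/-- f(z) = ∫ tz/(z−t) dν°(t). -/
def fR (ν : Measure ℝ) (z : ℂ) : ℂ :=
  ∫ t : ℝ, ((t : ℂ) * z) / (z - (t : ℂ)) ∂(centerR ν)

/-- The truncated second moment `∫ (s - a)² / (y² + (s - a)²) dν(s)` of the centering of `ν`. -/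
def truncMoment (ν : Measure ℝ) (y : ℝ) : ℝ :=
  ∫ s, (s - aR ν) ^ 2 / (y ^ 2 + (s - aR ν) ^ 2) ∂ν

lemma sq_add_sq_le_two_mul {y a t : ℝ} (hy : 1 ≤ y) (ha : |a| ≤ 1 / 2) :
    y ^ 2 + t ^ 2 ≤ 2 * (y ^ 2 + (t + a) ^ 2) := by
  have h := abs_le.1 ha
  nlinarith [sq_nonneg (t + 2 * a)]

lemma norm_sq_I_mul_sub (y t : ℝ) : ‖I * (y : ℂ) - (t : ℂ)‖ ^ 2 = y ^ 2 + t ^ 2 := by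
  rw [Complex.sq_norm, Complex.normSq_apply]
  simp
  ring

lemma I_mul_sub_ne_zero {y : ℝ} (hy : 1 ≤ y) (t : ℝ) : I * (y : ℂ) - (t : ℂ) ≠ 0 := by
  intro h
  have := norm_sq_I_mul_sub y t
  rw [h] at this
  simp at this
  nlinarith [sq_nonneg t]

section
variable {ν : Measure ℝ} {y : ℝ}

lemma sq_div_mem_Icc (hy : 1 ≤ y) (t : ℝ) : t ^ 2 / (y ^ 2 + t ^ 2) ∈ Set.Icc (0 : ℝ) 1 := by
  have : 0 < y ^ 2 + t ^ 2 := by positivity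
  exact ⟨by positivity, (div_le_one this).2 (by nlinarith)⟩

lemma truncMoment_nonneg (hy : 1 ≤ y) : 0 ≤ truncMoment ν y :=
  integral_nonneg fun _ => (sq_div_mem_Icc hy _).1

lemma fR_eq (y : ℝ) : fR ν (I * y) =
    ∫ s, (((s - aR ν : ℝ) : ℂ) * (I * y)) / (I * y - ((s - aR ν : ℝ) : ℂ)) ∂ν := by
  unfold fR centerR
  rw [integral_map (by fun_prop)]
  exact (Measurable.aestronglyMeasurable (by fun_prop))

variable [IsProbabilityMeasure ν]

lemma integrable_sq_div (hy : 1 ≤ y) (a : ℝ) :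
    Integrable (fun s : ℝ => (s - a) ^ 2 / (y ^ 2 + (s - a) ^ 2)) ν := by
  refine Integrable.of_bound (Measurable.aestronglyMeasurable (by fun_prop)) 1
    (ae_of_all _ fun s => ?_)
  obtain ⟨h0, h1⟩ := sq_div_mem_Icc hy (s - a)
  rwa [Real.norm_eq_abs, abs_of_nonneg h0]

lemma integrable_inv_sub (hy : 1 ≤ y) (a : ℝ) :
    Integrable (fun s : ℝ => (I * (y : ℂ) - ((s - a : ℝ) : ℂ))⁻¹) ν := by
  refine Integrable.of_bound (by fun_prop) 1 (ae_of_all _ fun s => ?_)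
  rw [norm_inv]
  refine inv_le_one_of_one_le₀ ?_
  have := norm_sq_I_mul_sub y (s - a)
  nlinarith [sq_nonneg (s - a), norm_nonneg (I * (y : ℂ) - ((s - a : ℝ) : ℂ))]

lemma kernel_eq (hy : 1 ≤ y) (t : ℝ) :
    ((t : ℂ) * (I * y)) / (I * y - (t : ℂ)) =
      (I * y) * ((I * y) * (I * y - (t : ℂ))⁻¹ - 1) := by
  have := I_mul_sub_ne_zero hy t
  field_simp
  ring

lemma integrable_kernel (hy : 1 ≤ y) (a : ℝ) :
    Integrable (fun s : ℝ =>
      (((s - a : ℝ) : ℂ) * (I * y)) / (I * y - ((s - a : ℝ) : ℂ))) ν := by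
  simp_rw [kernel_eq hy]
  exact (((integrable_inv_sub hy a).const_mul _).sub (integrable_const _)).const_mul _

lemma im_fR (hy : 1 ≤ y) : (fR ν (I * y)).im = -(y * truncMoment ν y) := by
  rw [fR_eq, truncMoment, ← integral_const_mul, ← integral_neg]
  have := integral_im (integrable_kernel (ν := ν) hy (aR ν))
  simp only [RCLike.im_to_complex] at this
  rw [← this]
  refine integral_congr_ae (ae_of_all _ fun s => ?_)
  generalize s - aR ν = t
  have h : (0 : ℝ) < y ^ 2 + t ^ 2 := by positivity
  have h' : t * t + y * y ≠ 0 := by nlinarith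
  simp [Complex.div_im, Complex.normSq_apply]
  field_simp
  ring

lemma abs_aR_le {ε : ℝ} (hε : 0 < ε) : |aR ν| ≤ ε + ν.real {t : ℝ | ε ≤ |t|} := by
  have hm : MeasurableSet {t : ℝ | |t| < 1} := measurableSet_lt (by fun_prop) (by fun_prop)
  have hm' : MeasurableSet {t : ℝ | ε ≤ |t|} := measurableSet_le (by fun_prop) (by fun_prop)
  rw [aR, ← integral_indicator hm, ← integral_indicator_one hm']
  have hi : Integrable ({t : ℝ | ε ≤ |t|}.indicator (1 : ℝ → ℝ)) ν :=
    (integrable_const (1 : ℝ)).indicator hm'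
  have : ε + ∫ t, {t : ℝ | ε ≤ |t|}.indicator (1 : ℝ → ℝ) t ∂ν =
      ∫ t, (ε + {t : ℝ | ε ≤ |t|}.indicator (1 : ℝ → ℝ) t) ∂ν := by
    rw [integral_add (integrable_const _) hi]; simp
  rw [this, ← Real.norm_eq_abs]
  refine norm_integral_le_of_norm_le ((integrable_const _).add hi) (ae_of_all _ fun t => ?_)
  simp only [Set.indicator_apply, Set.mem_ofPred_eq, Pi.one_apply, Real.norm_eq_abs]
  split_ifs <;> (try rw [abs_zero]) <;> linarith

lemma truncMoment_le (hy : 1 ≤ y) (ε : ℝ) :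
    truncMoment ν y ≤ (ε + |aR ν|) ^ 2 + ν.real {t : ℝ | ε ≤ |t|} := by
  have hm' : MeasurableSet {t : ℝ | ε ≤ |t|} := measurableSet_le (by fun_prop) (by fun_prop)
  have hi : Integrable ({t : ℝ | ε ≤ |t|}.indicator (1 : ℝ → ℝ)) ν :=
    (integrable_const (1 : ℝ)).indicator hm'
  have : (ε + |aR ν|) ^ 2 + ν.real {t : ℝ | ε ≤ |t|} =
      ∫ t, ((ε + |aR ν|) ^ 2 + {t : ℝ | ε ≤ |t|}.indicator (1 : ℝ → ℝ) t) ∂ν := by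
    rw [integral_add (integrable_const _) hi, integral_indicator_one hm']; simp
  rw [this, truncMoment]
  refine integral_mono (integrable_sq_div hy _) ((integrable_const _).add hi) fun t => ?_
  simp only [Set.indicator_apply, Set.mem_ofPred_eq, Pi.one_apply]
  split_ifs with h
  · have := (sq_div_mem_Icc hy (t - aR ν)).2
    nlinarith [sq_nonneg (ε + |aR ν|)]
  · rw [add_zero]
    have h1 : (t - aR ν) ^ 2 / (y ^ 2 + (t - aR ν) ^ 2) ≤ (t - aR ν) ^ 2 :=
      div_le_self (sq_nonneg _) (by nlinarith [sq_nonneg (t - aR ν)])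
    refine h1.trans (sq_le_sq.2 ?_)
    have h2 := abs_sub t (aR ν)
    have h3 := le_abs_self (ε + |aR ν|)
    linarith

lemma norm_kernel_sub_indicator_le (hy : 1 ≤ y) {a : ℝ} (ha : |a| ≤ 1 / 2) (s : ℝ) :
    ‖(((s - a : ℝ) : ℂ) * (I * y)) / (I * y - ((s - a : ℝ) : ℂ)) -
        (({t : ℝ | |t| < 1}.indicator (fun t => t - a) s : ℝ) : ℂ)‖ ≤
      (2 * y ^ 2 + y + 2) * ((s - a) ^ 2 / (y ^ 2 + (s - a) ^ 2)) := by
  have ha' := abs_le.1 ha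
  have hne := I_mul_sub_ne_zero hy (s - a)
  have hsq := norm_sq_I_mul_sub y (s - a)
  have hle : ‖I * (y : ℂ) - ((s - a : ℝ) : ℂ)‖ ≤ y + |s - a| := by
    refine (norm_sub_le _ _).trans_eq ?_
    rw [norm_mul, Complex.norm_I, Complex.norm_real, Complex.norm_real, Real.norm_eq_abs,
      Real.norm_eq_abs, abs_of_nonneg (by linarith : 0 ≤ y), one_mul]
  have hpos : 0 < ‖I * (y : ℂ) - ((s - a : ℝ) : ℂ)‖ := norm_pos_iff.2 hne
  by_cases hs : |s| < 1
  · have hs' := abs_lt.1 hs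
    have ht : |s - a| ≤ 3 / 2 := abs_le.2 ⟨by linarith, by linarith⟩
    rw [Set.indicator_of_mem (by exact hs)]
    generalize s - a = t at *
    have : (t : ℂ) * (I * y) / (I * y - (t : ℂ)) - (t : ℂ) = t ^ 2 / (I * y - (t : ℂ)) := by
      field_simp
      ring
    rw [this, norm_div, norm_pow, Complex.norm_real, Real.norm_eq_abs, sq_abs, ← hsq]
    set N := ‖I * (y : ℂ) - (t : ℂ)‖
    rw [← mul_div_assoc, div_le_div_iff₀ hpos (by positivity)]
    have : N ≤ 2 * y ^ 2 + y + 2 := by nlinarith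
    have := mul_le_mul_of_nonneg_right this (by positivity : 0 ≤ t ^ 2 * N)
    nlinarith
  · have ht : 1 / 2 ≤ |s - a| := by
      have := abs_sub_abs_le_abs_sub s a
      linarith
    rw [Set.indicator_of_notMem (by exact hs)]
    generalize s - a = t at *
    rw [Complex.ofReal_zero, sub_zero, norm_div, norm_mul, norm_mul, Complex.norm_I, one_mul,
      Complex.norm_real, Complex.norm_real, Real.norm_eq_abs, Real.norm_eq_abs,
      abs_of_nonneg (by linarith : 0 ≤ y), ← hsq, ← sq_abs t]
    set N := ‖I * (y : ℂ) - (t : ℂ)‖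
    rw [← mul_div_assoc, div_le_div_iff₀ hpos (by positivity)]
    have h1 : y * N ≤ (2 * y ^ 2 + y + 2) * |t| := by nlinarith [sq_nonneg y]
    have := mul_le_mul_of_nonneg_right h1 (by positivity : 0 ≤ |t| * N)
    nlinarith

lemma abs_integral_indicator_sub_aR_le (hy : 1 ≤ y) (ha : |aR ν| ≤ 1 / 2) :
    |∫ s, {t : ℝ | |t| < 1}.indicator (fun t => t - aR ν) s ∂ν| ≤
      (2 * y ^ 2 + 1) * truncMoment ν y := by
  have hm : MeasurableSet {t : ℝ | |t| < 1} := measurableSet_lt (by fun_prop) (by fun_prop)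
  have hid : IntegrableOn (fun t : ℝ => t) {t : ℝ | |t| < 1} ν := by
    refine Integrable.of_bound (by fun_prop) 1 ?_
    filter_upwards [ae_restrict_mem hm] with t ht using le_of_lt ht
  have h1 : ∫ s, {t : ℝ | |t| < 1}.indicator (fun t => t - aR ν) s ∂ν =
      aR ν * ν.real {t : ℝ | |t| < 1}ᶜ := by
    rw [integral_indicator hm, integral_sub hid (integrable_const _), ← aR, integral_const,
      probReal_compl_eq_one_sub hm]
    simp
    ring
  have h2 : ν.real {t : ℝ | |t| < 1}ᶜ ≤ (4 * y ^ 2 + 1) * truncMoment ν y := by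
    rw [← integral_indicator_one hm.compl, truncMoment, ← integral_const_mul]
    refine integral_mono ((integrable_const (1 : ℝ)).indicator hm.compl)
      ((integrable_sq_div hy _).const_mul _) fun s => ?_
    have hp : 0 < y ^ 2 + (s - aR ν) ^ 2 := by positivity
    simp only [Set.indicator_apply, Set.mem_compl_iff, Set.mem_ofPred_eq, Pi.one_apply]
    split_ifs with h
    · positivity
    · rw [← mul_div_assoc, le_div_iff₀ hp]
      have ht : 1 / 2 ≤ |s - aR ν| := by
        have := abs_sub_abs_le_abs_sub s (aR ν)
        linarith
      have : 1 / 4 ≤ (s - aR ν) ^ 2 := by rw [← sq_abs]; nlinarith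
      nlinarith [sq_nonneg y]
  rw [h1, abs_mul, abs_of_nonneg measureReal_nonneg]
  have := mul_le_mul ha h2 measureReal_nonneg (by norm_num)
  nlinarith [truncMoment_nonneg (ν := ν) hy]

lemma norm_fR_le (hy : 1 ≤ y) (ha : |aR ν| ≤ 1 / 2) :
    ‖fR ν (I * y)‖ ≤ (4 * y ^ 2 + y + 3) * truncMoment ν y := by
  have hm : MeasurableSet {t : ℝ | |t| < 1} := measurableSet_lt (by fun_prop) (by fun_prop)
  have hid : Integrable ({t : ℝ | |t| < 1}.indicator (fun t => t - aR ν)) ν := by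
    rw [integrable_indicator_iff hm]
    refine Integrable.of_bound (by fun_prop) (1 + |aR ν|) ?_
    filter_upwards [ae_restrict_mem hm] with t ht
    exact (abs_sub t _).trans (by simpa using le_of_lt ht)
  have hid' : Integrable
      (fun s => (({t : ℝ | |t| < 1}.indicator (fun t => t - aR ν) s : ℝ) : ℂ)) ν := hid.ofReal
  have h1 : ‖fR ν (I * y) -
      ((∫ s, {t : ℝ | |t| < 1}.indicator (fun t => t - aR ν) s ∂ν : ℝ) : ℂ)‖ ≤
      (2 * y ^ 2 + y + 2) * truncMoment ν y := by
    rw [fR_eq, ← integral_complex_ofReal, ← integral_sub (integrable_kernel hy _) hid',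
      truncMoment, ← integral_const_mul]
    exact norm_integral_le_of_norm_le ((integrable_sq_div hy _).const_mul _)
      (ae_of_all _ (norm_kernel_sub_indicator_le hy ha))
  have h2 := abs_integral_indicator_sub_aR_le hy ha
  rw [← Real.norm_eq_abs, ← Complex.norm_real] at h2
  have h3 := norm_le_norm_sub_add (fR ν (I * y))
    ((∫ s, {t : ℝ | |t| < 1}.indicator (fun t => t - aR ν) s ∂ν : ℝ) : ℂ)
  linarith

/-- The difference between `f` evaluated at `iy - a` and at `iy`. -/
lemma norm_shift_sub_fR_le (hy : 1 ≤ y) (ha : |aR ν| ≤ 1 / 2) :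
    ‖(I * y - aR ν) * ((I * y - aR ν) * cauchyT ν (I * y) - 1) - fR ν (I * y)‖ ≤
      2 * |aR ν| * truncMoment ν y := by
  have hi : Integrable (fun s : ℝ => (I * (y : ℂ) - (s : ℂ))⁻¹) ν := by
    simpa using integrable_inv_sub (ν := ν) hy 0
  have h1 : (I * y - aR ν) * ((I * y - aR ν) * cauchyT ν (I * y) - 1) =
      ∫ s : ℝ, (I * (y : ℂ) - aR ν) * ((I * y - aR ν) * (I * y - (s : ℂ))⁻¹ - 1) ∂ν := by
    rw [integral_const_mul, integral_sub (hi.const_mul _) (integrable_const _),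
      integral_const_mul, cauchyT]
    simp
  have hi' : Integrable (fun s : ℝ =>
      (I * (y : ℂ) - aR ν) * ((I * y - aR ν) * (I * y - (s : ℂ))⁻¹ - 1)) ν :=
    ((hi.const_mul _).sub (integrable_const _)).const_mul _
  rw [h1, fR_eq, ← integral_sub hi' (integrable_kernel hy _), truncMoment, ← integral_const_mul]
  refine norm_integral_le_of_norm_le ((integrable_sq_div hy _).const_mul _)
    (ae_of_all _ fun s => ?_)
  have hs := I_mul_sub_ne_zero hy s
  have ht := I_mul_sub_ne_zero hy (s - aR ν)
  have hsq := norm_sq_I_mul_sub y s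
  have htq := norm_sq_I_mul_sub y (s - aR ν)
  have hc := sq_add_sq_le_two_mul (t := s - aR ν) hy ha
  rw [sub_add_cancel, ← hsq, ← htq] at hc
  have key : (I * (y : ℂ) - aR ν) * ((I * y - aR ν) * (I * y - (s : ℂ))⁻¹ - 1) -
      (((s - aR ν : ℝ) : ℂ) * (I * y)) / (I * y - ((s - aR ν : ℝ) : ℂ)) =
      (aR ν : ℂ) * (((s - aR ν : ℝ) : ℂ) ^ 2 /
        ((I * y - (s : ℂ)) * (I * y - ((s - aR ν : ℝ) : ℂ)))) := by
    field_simp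
    push_cast
    ring
  rw [key, norm_mul, norm_div, norm_pow, norm_mul, Complex.norm_real, Complex.norm_real,
    Real.norm_eq_abs, Real.norm_eq_abs, sq_abs, ← htq, mul_comm 2 |aR ν|, mul_assoc]
  have hp := norm_pos_iff.2 hs
  have hq := norm_pos_iff.2 ht
  set P := ‖I * (y : ℂ) - (s : ℂ)‖
  set Q := ‖I * (y : ℂ) - ((s - aR ν : ℝ) : ℂ)‖
  have hQP : Q ≤ 2 * P := by nlinarith
  refine mul_le_mul_of_nonneg_left ?_ (abs_nonneg _)
  rw [← mul_div_assoc, div_le_div_iff₀ (by positivity) (by positivity)]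
  have := mul_le_mul_of_nonneg_right hQP (by positivity : 0 ≤ (s - aR ν) ^ 2 * Q)
  nlinarith

lemma norm_ET_sub_le (hy : 1 ≤ y) (ha : |aR ν| ≤ 1 / 2)
    (hM : (4 * y ^ 2 + y + 4) * truncMoment ν y ≤ 1 / 2) :
    ‖ET ν (I * y) - (aR ν + fR ν (I * y))‖ ≤
      (2 * |aR ν| + 2 * (4 * y ^ 2 + y + 4) ^ 2 * truncMoment ν y) * truncMoment ν y := by
  have h1 := norm_shift_sub_fR_le (ν := ν) hy ha
  have h2 := norm_fR_le (ν := ν) hy ha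
  have h0 := truncMoment_nonneg (ν := ν) hy
  have hw0 := I_mul_sub_ne_zero hy (aR ν)
  have hwsq := norm_sq_I_mul_sub y (aR ν)
  set w : ℂ := I * y - aR ν with hw
  set G := cauchyT ν (I * y) with hG
  set f := fR ν (I * y)
  set M := truncMoment ν y
  set g := w * (w * G - 1) with hg
  have hwn : 1 ≤ ‖w‖ := by nlinarith [sq_nonneg (aR ν), norm_nonneg w]
  have hgC : ‖g‖ ≤ (4 * y ^ 2 + y + 4) * M := by
    have := norm_le_norm_sub_add g f
    nlinarith
  have hwG : w * G = 1 + g / w := by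
    rw [hg]
    field_simp
    ring
  have hgw : ‖g / w‖ ≤ ‖g‖ := by
    rw [norm_div]
    exact div_le_self (norm_nonneg _) hwn
  have hwGn : 1 / 2 ≤ ‖w * G‖ := by
    have := norm_sub_le (1 + g / w) (g / w)
    rw [add_sub_cancel_right, norm_one] at this
    rw [hwG]
    linarith
  have hwG0 : w * G ≠ 0 := norm_pos_iff.1 (by linarith)
  have hG0 : G ≠ 0 := right_ne_zero_of_mul hwG0
  have key : ET ν (I * y) - (aR ν + f) = (g - f) - g * (g / w) / (w * G) := by
    have : ET ν (I * y) = w + aR ν - G⁻¹ := by rw [ET, ← hG, hw]; ring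
    rw [this, hg]
    field_simp
    ring
  have h3 : ‖g * (g / w) / (w * G)‖ ≤ 2 * ((4 * y ^ 2 + y + 4) * M) ^ 2 := by
    rw [norm_div, norm_mul, div_le_iff₀ (by linarith)]
    have h4 : ‖g‖ * ‖g / w‖ ≤ ((4 * y ^ 2 + y + 4) * M) ^ 2 := by
      rw [sq]
      exact mul_le_mul hgC (hgw.trans hgC) (norm_nonneg _) ((norm_nonneg _).trans hgC)
    nlinarith [sq_nonneg ((4 * y ^ 2 + y + 4) * M)]
  rw [key]
  refine (norm_sub_le _ _).trans ((add_le_add h1 h3).trans_eq ?_)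
  ring

end

lemma IsInfinitesimalArrayR.eventually_small {kn : ℕ → ℕ} {ν : ℕ → ℕ → Measure ℝ}
    (hprob : ∀ n i, IsProbabilityMeasure (ν n i)) (hinf : IsInfinitesimalArrayR kn ν)
    {y : ℝ} (hy : 1 ≤ y) {η : ℝ} (hη : 0 < η) :
    ∀ᶠ n in atTop, ∀ i < kn n, |aR (ν n i)| ≤ η ∧ truncMoment (ν n i) y ≤ η := by
  obtain ⟨ε, hε, hε1, hεη⟩ : ∃ ε : ℝ, 0 < ε ∧ ε ≤ 1 ∧ 10 * ε ≤ η :=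
    ⟨min 1 (η / 10), by positivity, min_le_left _ _, by linarith [min_le_right 1 (η / 10)]⟩
  obtain ⟨N, hN⟩ := hinf ε hε (ENNReal.ofReal ε) (by simpa using hε)
  filter_upwards [eventually_ge_atTop N] with n hn i hi
  have hν : (ν n i).real {t : ℝ | ε ≤ |t|} ≤ ε :=
    ENNReal.toReal_le_of_le_ofReal hε.le (hN n hn i hi).le
  have := hprob n i
  have h1 := abs_aR_le (ν := ν n i) hε
  have h2 := truncMoment_le (ν := ν n i) hy ε
  have h3 := abs_nonneg (aR (ν n i))
  exact ⟨by linarith, by nlinarith⟩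

/-- The two centered sums are asymptotically equivalent, without any convergence assumption. -/
lemma isEquivalent_sum_ET {kn : ℕ → ℕ} {ν : ℕ → ℕ → Measure ℝ}
    (hprob : ∀ n i, IsProbabilityMeasure (ν n i)) (hinf : IsInfinitesimalArrayR kn ν)
    (c : ℕ → ℝ) {y : ℝ} (hy : 1 ≤ y) :
    Asymptotics.IsEquivalent atTop
      (fun n => (c n : ℂ) + ∑ i ∈ Finset.range (kn n), ET (ν n i) (I * y))
      (fun n => (c n : ℂ) +
        ∑ i ∈ Finset.range (kn n), ((aR (ν n i) : ℂ) + fR (ν n i) (I * y))) := by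
  refine Asymptotics.isLittleO_iff.2 fun η hη => ?_
  set C := 4 * y ^ 2 + y + 4 with hC
  have hC0 : 0 < C := by positivity
  obtain ⟨δ, hδ, hδ1, hδ2, hδ3⟩ :
      ∃ δ : ℝ, 0 < δ ∧ δ ≤ 1 / 2 ∧ C * δ ≤ 1 / 2 ∧ (2 + 2 * C ^ 2) * δ ≤ η := by
    refine ⟨min (1 / 2) (min (1 / 2 / C) (η / (2 + 2 * C ^ 2))), by positivity,
      min_le_left _ _, ?_, ?_⟩
    · rw [mul_comm, ← le_div_iff₀ hC0]
      exact (min_le_right _ _).trans (min_le_left _ _)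
    · rw [mul_comm, ← le_div_iff₀ (by positivity)]
      exact (min_le_right _ _).trans (min_le_right _ _)
  filter_upwards [hinf.eventually_small hprob hy hδ] with n hn
  have hterm : ∀ i ∈ Finset.range (kn n),
      ‖ET (ν n i) (I * y) - (aR (ν n i) + fR (ν n i) (I * y))‖ ≤
        η * truncMoment (ν n i) y := by
    intro i hi
    obtain ⟨ha, hM⟩ := hn i (Finset.mem_range.1 hi)
    have := hprob n i
    refine (norm_ET_sub_le hy (ha.trans hδ1)
      ((mul_le_mul_of_nonneg_left hM hC0.le).trans hδ2)).trans
      (mul_le_mul_of_nonneg_right ?_ (truncMoment_nonneg hy))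
    have := mul_le_mul_of_nonneg_left hM (by positivity : 0 ≤ 2 * C ^ 2)
    rw [← hC]
    linarith
  have hS : ∑ i ∈ Finset.range (kn n), truncMoment (ν n i) y ≤
      ‖(c n : ℂ) + ∑ i ∈ Finset.range (kn n), ((aR (ν n i) : ℂ) + fR (ν n i) (I * y))‖ := by
    refine le_trans ?_ (Complex.abs_im_le_norm _)
    have him : ((c n : ℂ) + ∑ i ∈ Finset.range (kn n),
        ((aR (ν n i) : ℂ) + fR (ν n i) (I * y))).im =
        -(y * ∑ i ∈ Finset.range (kn n), truncMoment (ν n i) y) := by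
      simp only [Complex.add_im, Complex.ofReal_im, Complex.im_sum, zero_add]
      rw [Finset.mul_sum, ← Finset.sum_neg_distrib]
      exact Finset.sum_congr rfl fun i _ => have := hprob n i; im_fR hy
    have h0 : 0 ≤ ∑ i ∈ Finset.range (kn n), truncMoment (ν n i) y :=
      Finset.sum_nonneg fun i _ => have := hprob n i; truncMoment_nonneg hy
    rw [him, abs_neg]
    exact (le_mul_of_one_le_left h0 hy).trans (le_abs_self _)
  calc _ = ‖∑ i ∈ Finset.range (kn n),
        (ET (ν n i) (I * y) - (aR (ν n i) + fR (ν n i) (I * y)))‖ := by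
        rw [Finset.sum_sub_distrib, Pi.sub_apply, add_sub_add_left_eq_sub]
    _ ≤ ∑ i ∈ Finset.range (kn n), η * truncMoment (ν n i) y := norm_sum_le_of_le _ hterm
    _ ≤ _ := by
        rw [← Finset.mul_sum]
        exact mul_le_mul_of_nonneg_left hS hη.le

/-- Proposition 5.2 (1): for fixed y ≥ 1, the sequence c_n + Σ_k E_{ν_{nk}}(iy) converges
iff c_n + Σ_k [a_{nk} + f_{nk}(iy)] converges, and the limits coincide. -/
theorem stmt16
    (kn : ℕ → ℕ) (ν : ℕ → ℕ → Measure ℝ)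
    (hprob : ∀ n i, IsProbabilityMeasure (ν n i))
    (hinf : IsInfinitesimalArrayR kn ν)
    (c : ℕ → ℝ) (y : ℝ) (hy : 1 ≤ y) :
    ∀ L : ℂ,
      Tendsto (fun n => ((c n : ℝ) : ℂ) +
          ∑ i ∈ Finset.range (kn n), ET (ν n i) (Complex.I * (y : ℂ)))
        atTop (𝓝 L) ↔
      Tendsto (fun n => ((c n : ℝ) : ℂ) +
          ∑ i ∈ Finset.range (kn n),
            (((aR (ν n i) : ℝ) : ℂ) + fR (ν n i) (Complex.I * (y : ℂ))))
        atTop (𝓝 L) := by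
  exact fun _ => (isEquivalent_sum_ET hprob hinf c hy).tendsto_nhds_iff

end
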